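/- For every n ≥ 2138 with n ≡ n, if there exist nonnegative integers a, b with n − 98 = 41a + 52b, and w = x w' y (with x, y ∈ V(D)) is any square-free walk in the digraph D of length a + b, then the set δ(w) contains a word W of length n − 98, and the unique word in δ(p_x) W δ(s_y) is an extremal square-free word of length n over Γ = {a, b, c}. In particular, for every integer n ≥ 2138 there exists an extremal square-free word of length n over Γ. -/

import Mathlib

/-- A word `w` is square-free if it contains no factor `x ++ x` with `x` nonempty. -/
def SquareFree {α : Type*} (w : List α) : Prop :=
  ∀ x : List α, x ≠ [] → ¬ (x ++ x) <:+: w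

/-- `v` is an extension of `w`: insert a single letter anywhere in `w`. -/
def IsExtension {α : Type*} (w v : List α) : Prop :=
  ∃ (w' w'' : List α) (a : α), w = w' ++ w'' ∧ v = w' ++ [a] ++ w''

/-- `w` is extremal square-free. -/
def ExtremalSquareFree {α : Type*} (w : List α) : Prop :=
  SquareFree w ∧ ∀ v, IsExtension w v → ¬ SquareFree v

/-- Extension of a set-valued substitution from letters to words:
`SubstSet f (a₁ ⋯ aₙ) = {A₁ ++ ⋯ ++ Aₙ : Aᵢ ∈ f aᵢ}`. -/
def SubstSet {α β : Type*} (f : α → Set (List β)) : List α → Set (List β)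
  | [] => {[]}
  | a :: w => {W | ∃ A ∈ f a, ∃ B ∈ SubstSet f w, W = A ++ B}

/-- The word `P = abacbcabcbacabacbcabcbabcacbcabcbacabacbcabcbacbc` (a=0, b=1, c=2). -/
def Pw : List (Fin 3) :=
  [0,1,0,2,1,2,0,1,2,1,0,2,0,1,0,2,1,2,0,1,2,1,0,1,2,0,2,1,2,0,1,2,1,0,2,0,1,0,2,1,2,0,1,2,1,0,2,1,2]

/-- The word `Q = abacbabcacbacabacbcacbacabcbabcabacbcabcb`. -/
def Qw : List (Fin 3) :=
  [0,1,0,2,1,0,1,2,0,2,1,0,2,0,1,0,2,1,2,0,2,1,0,2,0,1,2,1,0,1,2,0,1,0,2,1,2,0,1,2,1]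

/-- The word `R = abacabcacbacabcbabcacbacabacbcacbacabcbabcabacbcabcb`. -/
def Rw : List (Fin 3) :=
  [0,1,0,2,0,1,2,0,2,1,0,2,0,1,2,1,0,1,2,0,2,1,0,2,0,1,0,2,1,2,0,2,1,0,2,0,1,2,1,0,1,2,0,1,0,2,1,2,0,1,2,1]

/-- The word `S = acabacbabcacbacabcbacbcabacbabcacbacabcbabcacbaca`. -/
def Sw : List (Fin 3) :=
  [0,2,0,1,0,2,1,0,1,2,0,2,1,0,2,0,1,2,1,0,2,1,2,0,1,0,2,1,0,1,2,0,2,1,0,2,0,1,2,1,0,1,2,0,2,1,0,2,0]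

/-- The identity permutation `()` of `Γ = {a,b,c}` (with `a = 0`, `b = 1`, `c = 2`). -/
def pid : Equiv.Perm (Fin 3) := 1
/-- The permutation `(ab)`. -/
def pab : Equiv.Perm (Fin 3) := Equiv.swap 0 1
/-- The permutation `(ac)`. -/
def pac : Equiv.Perm (Fin 3) := Equiv.swap 0 2
/-- The permutation `(bc)`. -/
def pbc : Equiv.Perm (Fin 3) := Equiv.swap 1 2
/-- The permutation `(abc)`, i.e. `a ↦ b ↦ c ↦ a`. -/
def pabc : Equiv.Perm (Fin 3) := (Equiv.swap 0 1).trans (Equiv.swap 0 2)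
/-- The permutation `(acb)`, i.e. `a ↦ c ↦ b ↦ a`. -/
def pacb : Equiv.Perm (Fin 3) := (Equiv.swap 0 2).trans (Equiv.swap 0 1)

/-- The vertex set `V(D) = S_Γ ∪ S̃_Γ`: a permutation `π` together with a Boolean
which is `false` for the plain letter `π` and `true` for its mirror image `π̃`. -/
abbrev V : Type := Equiv.Perm (Fin 3) × Bool

/-- The 24 arcs of the digraph `D`. -/
def arcs : List (V × V) :=
  [((pid,false),(pab,true)), ((pac,true),(pid,false)), ((pab,false),(pid,true)),
   ((pacb,true),(pab,false)), ((pid,true),(pac,false)), ((pac,false),(pabc,true)),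
   ((pabc,true),(pbc,false)), ((pbc,false),(pacb,true)), ((pabc,false),(pac,true)),
   ((pbc,true),(pabc,false)), ((pab,true),(pacb,false)), ((pacb,false),(pbc,true)),
   ((pid,false),(pbc,false)), ((pbc,false),(pid,false)), ((pab,false),(pabc,false)),
   ((pabc,false),(pab,false)), ((pac,false),(pacb,false)), ((pacb,false),(pac,false)),
   ((pbc,true),(pid,true)), ((pid,true),(pbc,true)), ((pabc,true),(pab,true)),
   ((pab,true),(pabc,true)), ((pacb,true),(pac,true)), ((pac,true),(pacb,true))]

/-- The arc relation of the digraph `D`. -/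
def Arc (x y : V) : Prop := (x, y) ∈ arcs

/-- For `x = (π, false)` this is `W_π` (permute letters by `π`);
for `x = (π, true)` this is `W_π̃` (the reversal of `W_π`). -/
def applyV (x : V) (w : List (Fin 3)) : List (Fin 3) :=
  if x.2 then (w.map x.1).reverse else w.map x.1

/-- The vertex set of `D̂`: original vertices `Sum.inl x`, plus the new letters
`p_x = Sum.inr (x, false)` and `s_x = Sum.inr (x, true)`. -/
abbrev Vhat : Type := V ⊕ (V × Bool)

/-- The arc relation of the digraph `D̂`: the arcs of `D`, together with an arc
from `p_x` to `x` and an arc from `x` to `s_x`, for each vertex `x` of `D`. -/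
def ArcHat : Vhat → Vhat → Prop
  | Sum.inl x, Sum.inl y => Arc x y
  | Sum.inr (x, false), Sum.inl y => x = y
  | Sum.inl x, Sum.inr (y, true) => x = y
  | _, _ => False

/-- The unique word in `δ(p_x)`: `P_x` if `x ∈ S_Γ`, and `S_x` if `x ∈ S̃_Γ`. -/
def pword (x : V) : List (Fin 3) := applyV x (if x.2 then Sw else Pw)

/-- The unique word in `δ(s_x)`: `S_x` if `x ∈ S_Γ`, and `P_x` if `x ∈ S̃_Γ`. -/
def sword (x : V) : List (Fin 3) := applyV x (if x.2 then Pw else Sw)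

/-- The substitution `δ` on the letters of `V(D̂)`. -/
def delta : Vhat → Set (List (Fin 3))
  | Sum.inl x => {applyV x Qw, applyV x Rw}
  | Sum.inr (x, false) => {pword x}
  | Sum.inr (x, true) => {sword x}


section SyncCode

variable {L α β : Type*}

/-- Two words are incomparable if neither is a prefix of the other. -/
def Incomparable (u v : List α) : Prop := ¬ u <+: v ∧ ¬ v <+: u

/-- A substitution `h` such that, along chains of `E`, block boundaries are recognised by the
next `N + 1` letters, and blocks sharing a prefix of length `q` or a suffix of length `p` have
the same label under `f`. -/
structure IsSyncCode (E : L → L → Prop) (f : L → β) (h : L → List α) (N p q : ℕ) : Prop where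
  p_pos : 0 < p
  q_pos : 0 < q
  add_le : p + q ≤ N + 1
  le_length : ∀ a, N ≤ (h a).length
  eq_of_prefix : ∀ a b, h a <+: h b → a = b
  label_eq_of_prefix : ∀ a b u, q ≤ u.length → u <+: h a → u <+: h b → f a = f b
  label_eq_of_suffix : ∀ a b u, p ≤ u.length → u <:+ h a → u <:+ h b → f a = f b
  sync_single : ∀ a c o, 0 < o → o + (N + 1) ≤ (h a).length →
    Incomparable (((h a).drop o).take (N + 1)) (h c)
  sync_pair : ∀ a b c o, E a b → 0 < o → o < (h a).length →
    Incomparable (((h a).drop o ++ h b).take (N + 1)) (h c)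
  squareFree_short : ∀ u : List L, u.length ≤ 3 → u.IsChain E → SquareFree (u.flatMap h)

/-- `i` is the position of a block boundary in `ls.flatMap h`. -/
def IsCut (h : L → List α) (ls : List L) (i : ℕ) : Prop :=
  ∃ l₁ l₂, ls = l₁ ++ l₂ ∧ (l₁.flatMap h).length = i

theorem SquareFree.of_infix {u w : List α} (hw : SquareFree w) (h : u <:+: w) : SquareFree u :=
  fun x hx hs => hw x hx (hs.trans h)

theorem SquareFree.of_map (f : α → β) {w : List α} (h : SquareFree (w.map f)) :
    SquareFree w := by
  intro x hx hs
  refine h (x.map f) (by simpa using hx) ?_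
  simpa using hs.map f

theorem SquareFree.map {f : α → β} (hf : Function.Injective f) {w : List α}
    (h : SquareFree w) : SquareFree (w.map f) := by
  rintro x hx ⟨s, t, hst⟩
  obtain ⟨u, t', rfl, hu, rfl⟩ := List.map_eq_append_iff.1 hst.symm
  obtain ⟨s', v, rfl, rfl, hv⟩ := List.map_eq_append_iff.1 hu
  obtain ⟨x₁, x₂, rfl, rfl, h₂⟩ := List.map_eq_append_iff.1 hv
  obtain rfl := List.map_injective_iff.2 hf h₂
  exact h x₂ (by simpa using hx) ⟨s', t', rfl⟩

theorem exists_block_at (h : L → List α) (ls : List L) (j : ℕ) (hj : j < (ls.flatMap h).length) :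
    ∃ l₁ a l₂, ls = l₁ ++ a :: l₂ ∧ (l₁.flatMap h).length ≤ j ∧
      j < (l₁.flatMap h).length + (h a).length := by
  induction ls generalizing j with
  | nil => simp at hj
  | cons a l ih =>
    by_cases hja : j < (h a).length
    · exact ⟨[], a, l, rfl, by simp, by simpa using hja⟩
    · rw [List.flatMap_cons, List.length_append] at hj
      obtain ⟨l₁, b, l₂, rfl, h₁, h₂⟩ := ih (j - (h a).length) (by omega)
      refine ⟨a :: l₁, b, l₂, rfl, ?_, ?_⟩ <;> rw [List.flatMap_cons, List.length_append] <;> omega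

/-- Two lists of blocks whose images share the prefix `W` agree up to the block in which `W`
ends. -/
theorem exists_common_letters {h : L → List α} (hpos : ∀ a, 0 < (h a).length)
    (hpre : ∀ a b, h a <+: h b → a = b)
    (l m : List L) (W : List α) (hl : W <+: l.flatMap h) (hm : W <+: m.flatMap h) :
    ∃ c l' m' W', l = c ++ l' ∧ m = c ++ m' ∧ W = c.flatMap h ++ W' ∧ W' <+: l'.flatMap h ∧
      W' <+: m'.flatMap h ∧ (∀ z ∈ l'.head?, W'.length < (h z).length) ∧
      (∀ z ∈ m'.head?, W'.length < (h z).length) := by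
  induction l generalizing m W with
  | nil =>
    obtain rfl : W = [] := by simpa using hl
    exact ⟨[], [], m, [], rfl, rfl, rfl, by simp, by simp, by simp, fun z _ => hpos z⟩
  | cons a l ih =>
    cases m with
    | nil =>
      obtain rfl : W = [] := by simpa using hm
      exact ⟨[], a :: l, [], [], rfl, rfl, rfl, by simp, by simp, fun z _ => hpos z, by simp⟩
    | cons b m =>
      by_cases hab : W.length < (h a).length ∧ W.length < (h b).length
      · refine ⟨[], a :: l, b :: m, W, rfl, rfl, rfl, hl, hm, ?_, ?_⟩ <;> simp [hab.1, hab.2]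
      · rw [List.flatMap_cons] at hl hm
        have ha : h a <+: h a ++ l.flatMap h := List.prefix_append _ _
        have hb : h b <+: h b ++ m.flatMap h := List.prefix_append _ _
        obtain rfl : a = b := by
          by_cases h₁ : (h a).length ≤ W.length
          · have haW := List.prefix_of_prefix_length_le ha hl h₁
            rcases List.prefix_or_prefix_of_prefix (haW.trans hm) hb with h₂ | h₂
            · exact hpre _ _ h₂
            · exact (hpre _ _ h₂).symm
          · have h₁' : (h b).length ≤ W.length := by omega
            have hbW := List.prefix_of_prefix_length_le hb hm h₁'
            rcases List.prefix_or_prefix_of_prefix (hbW.trans hl) ha with h₂ | h₂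
            · exact (hpre _ _ h₂).symm
            · exact hpre _ _ h₂
        obtain ⟨W₁, rfl⟩ := List.prefix_of_prefix_length_le ha hl (by omega)
        rw [List.prefix_append_right_inj] at hl hm
        obtain ⟨c, l', m', W', rfl, rfl, rfl, h₁, h₂, h₃, h₄⟩ := ih m W₁ hl hm
        exact ⟨a :: c, l', m', W', rfl, rfl, by simp, h₁, h₂, h₃, h₄⟩

namespace IsSyncCode

variable {E : L → L → Prop} {f : L → β} {h : L → List α} {N p q : ℕ}

theorem length_pos (H : IsSyncCode E f h N p q) (a : L) : 0 < (h a).length := by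
  have := H.le_length a
  have := H.p_pos
  have := H.q_pos
  have := H.add_le
  omega

/-- Block boundaries are recognised by the next `N + 1` letters. -/
theorem isCut_of_take_eq (H : IsSyncCode E f h N p q) {ls : List L} (hc : ls.IsChain E)
    {i j : ℕ} (hi : IsCut h ls i) (hj : j + (N + 1) ≤ (ls.flatMap h).length)
    (hij : ((ls.flatMap h).drop j).take (N + 1) = ((ls.flatMap h).drop i).take (N + 1)) :
    IsCut h ls j := by
  obtain ⟨l₁, a, l₂, rfl, h₁, h₂⟩ := exists_block_at h ls j (by omega)
  obtain ⟨m₁, m₂, hm, rfl⟩ := hi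
  by_contra hcut
  have hne : (l₁.flatMap h).length ≠ j := fun h₀ => hcut ⟨l₁, _, rfl, h₀⟩
  have hdj : ((l₁ ++ a :: l₂).flatMap h).drop j
      = (h a).drop (j - (l₁.flatMap h).length) ++ l₂.flatMap h := by
    rw [List.flatMap_append, List.drop_append, List.drop_eq_nil_of_le h₁, List.nil_append,
      List.flatMap_cons, List.drop_append_of_le_length (by omega)]
  have hdi : ((l₁ ++ a :: l₂).flatMap h).drop (m₁.flatMap h).length = m₂.flatMap h := by
    rw [hm, List.flatMap_append, List.drop_left]
  rw [hdj, hdi] at hij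
  simp only [List.flatMap_append, List.flatMap_cons, List.length_append] at hj
  cases m₂ with
  | nil =>
    have := congrArg List.length hij
    simp only [List.flatMap_nil, List.take_nil, List.length_nil, List.length_take,
      List.length_append, List.length_drop] at this
    omega
  | cons c m₃ =>
    have hcm : h c <+: h c ++ m₃.flatMap h := List.prefix_append _ _
    cases l₂ with
    | nil =>
      rw [List.flatMap_nil, List.append_nil] at hij
      obtain ⟨h₃, h₄⟩ := H.sync_single a c (j - (l₁.flatMap h).length) (by omega)
        (by simp only [List.flatMap_nil, List.length_nil] at hj; omega)
      rw [hij, List.flatMap_cons] at h₃ h₄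
      exact (List.prefix_or_prefix_of_prefix (List.take_prefix _ _) hcm).elim h₃ h₄
    | cons b l₃ =>
      have hE : E a b := by
        have := (List.isChain_append.1 hc).2.1
        exact (List.isChain_cons_cons.1 this).1
      obtain ⟨h₃, h₄⟩ := H.sync_pair a b c (j - (l₁.flatMap h).length) hE (by omega) (by omega)
      have hb := H.le_length b
      rw [List.flatMap_cons, ← List.append_assoc, List.take_append_of_le_length (by
        rw [List.length_append, List.length_drop]; omega)] at hij
      rw [hij, List.flatMap_cons] at h₃ h₄
      exact (List.prefix_or_prefix_of_prefix (List.take_prefix _ _) hcm).elim h₃ h₄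

/-- A square whose halves contain no recognised boundary lies in at most three blocks. -/
theorem exists_short_infix (H : IsSyncCode E f h N p q) {ls : List L} {U X Z : List α}
    (hX : X ≠ []) (hT : ls.flatMap h = U ++ (X ++ X) ++ Z)
    (hcut : ∀ t, t + (N + 1) ≤ X.length → ¬ IsCut h ls (U.length + t) ∧
      ¬ IsCut h ls (U.length + X.length + t)) :
    ∃ u : List L, u <:+: ls ∧ u.length ≤ 3 ∧ (X ++ X) <:+: u.flatMap h := by
  have hXpos : 0 < X.length := List.length_pos_iff.2 hX
  have hlen := congrArg List.length hT
  simp only [List.length_append] at hlen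
  obtain ⟨l₁, a, l₂, rfl, h₁, h₂⟩ := exists_block_at h ls U.length (by omega)
  have hlen' := hlen
  rw [List.flatMap_append, List.length_append] at hlen'
  obtain ⟨v, b, m₂, hv, h₃, h₄⟩ := exists_block_at h (a :: l₂)
    (U.length + X.length + X.length - 1 - (l₁.flatMap h).length) (by omega)
  refine ⟨v ++ [b], ⟨l₁, m₂, by rw [hv]; simp⟩, ?_, ?_⟩
  · by_contra hv3
    match v, hv, h₃, hv3 with
    | a' :: b' :: c' :: v', hv, h₃, _ =>
      obtain ⟨rfl, rfl⟩ : a = a' ∧ l₂ = b' :: c' :: v' ++ b :: m₂ := by simpa using hv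
      have hb := H.le_length b'
      have hc := H.le_length c'
      simp only [List.flatMap_cons, List.length_append] at h₃
      have hcuts : ∀ i, U.length ≤ i → IsCut h (l₁ ++ a :: (b' :: c' :: v' ++ b :: m₂)) i →
          (i < U.length + X.length → U.length + X.length ≤ i + N) ∧
          (U.length + X.length ≤ i → U.length + X.length + X.length ≤ i + N) := by
        intro i hi hcuti
        refine ⟨fun h₅ => ?_, fun h₅ => ?_⟩
        · by_contra h₆
          refine (hcut (i - U.length) (by omega)).1 ?_
          rwa [Nat.add_sub_cancel' hi]
        · by_contra h₆
          refine (hcut (i - (U.length + X.length)) (by omega)).2 ?_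
          rwa [Nat.add_sub_cancel' h₅]
      have c₁ := hcuts ((l₁.flatMap h).length + (h a).length) (by omega)
        ⟨l₁ ++ [a], b' :: c' :: v' ++ b :: m₂, by simp, by simp⟩
      have c₂ := hcuts ((l₁.flatMap h).length + (h a).length + (h b').length) (by omega)
        ⟨l₁ ++ [a, b'], c' :: v' ++ b :: m₂, by simp, by simp; omega⟩
      omega
    | [], _, _, hv3 => simp at hv3
    | [_], _, _, hv3 => simp at hv3
    | [_, _], _, _, hv3 => simp at hv3
  · have hdec : l₁.flatMap h ++ ((v ++ [b]).flatMap h ++ m₂.flatMap h) = U ++ (X ++ X ++ Z) := by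
      rw [← List.append_assoc U, ← hT, hv]
      simp
    obtain ⟨s, rfl⟩ : l₁.flatMap h <+: U :=
      List.prefix_of_prefix_length_le (List.prefix_append _ _) (hdec.symm ▸ List.prefix_append _ _) h₁
    rw [List.append_assoc, List.append_cancel_left_eq] at hdec
    have hs : s ++ (X ++ X) <+: (v ++ [b]).flatMap h := by
      refine List.prefix_of_prefix_length_le (l₃ := (v ++ [b]).flatMap h ++ m₂.flatMap h) ?_
        (List.prefix_append _ _) ?_
      · rw [hdec, List.prefix_append_right_inj]
        exact List.prefix_append _ _
      · simp only [List.length_append, List.flatMap_append, List.flatMap_singleton] at h₃ h₄ ⊢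
        omega
    exact (List.suffix_append s _).isInfix.trans hs.isInfix

/-- A substitution that synchronises sends chains with square-free labels to square-free words. -/
theorem squareFree_flatMap (H : IsSyncCode E f h N p q) {ls : List L} (hc : ls.IsChain E)
    (hf : SquareFree (ls.map f)) : SquareFree (ls.flatMap h) := by
  rintro X hX ⟨U, Z, hT⟩
  have hXpos : 0 < X.length := List.length_pos_iff.2 hX
  have hlen := congrArg List.length hT
  simp only [List.length_append] at hlen
  have hsq : ∀ s c c' t : List L, ls = s ++ c ++ c' ++ t → c.map f = c'.map f → c = [] := by
    intro s c c' t hls hcc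
    by_contra hne
    refine hf (c.map f) (by simpa using hne) ⟨s.map f, t.map f, ?_⟩
    rw [hls]
    simp [hcc]
  have hd₁ : ∀ t ≤ X.length, (ls.flatMap h).drop (U.length + t) = X.drop t ++ (X ++ Z) := by
    intro t ht
    rw [← hT, List.append_assoc, ← List.drop_drop, List.drop_left, List.append_assoc,
      List.drop_append_of_le_length ht]
  have hd₂ : ∀ t ≤ X.length,
      (ls.flatMap h).drop (U.length + X.length + t) = X.drop t ++ Z := by
    intro t ht
    rw [← hT, List.append_assoc, ← List.drop_drop, ← List.drop_drop, List.drop_left,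
      List.append_assoc, List.drop_left, List.drop_append_of_le_length ht]
  have htake : ∀ t, t + (N + 1) ≤ X.length →
      ((ls.flatMap h).drop (U.length + t)).take (N + 1)
        = ((ls.flatMap h).drop (U.length + X.length + t)).take (N + 1) := by
    intro t ht
    rw [hd₁ t (by omega), hd₂ t (by omega), List.take_append_of_le_length (by simp; omega),
      List.take_append_of_le_length (by simp; omega)]
  have hfwd : ∀ t, t + (N + 1) ≤ X.length → IsCut h ls (U.length + t) →
      IsCut h ls (U.length + X.length + t) := fun t ht hcut =>
    H.isCut_of_take_eq hc hcut (by omega) (htake t ht).symm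
  have hbwd : ∀ t, t + (N + 1) ≤ X.length → IsCut h ls (U.length + X.length + t) →
      IsCut h ls (U.length + t) := fun t ht hcut =>
    H.isCut_of_take_eq hc hcut (by omega) (htake t ht)
  by_cases hex : ∃ t, t + (N + 1) ≤ X.length ∧ IsCut h ls (U.length + t)
  · classical
    obtain ⟨t, ⟨ht, hcut⟩, hmin⟩ : ∃ t, (t + (N + 1) ≤ X.length ∧ IsCut h ls (U.length + t)) ∧
        ∀ t' < t, ¬ IsCut h ls (U.length + t') := by
      refine ⟨Nat.find hex, Nat.find_spec hex, fun t' ht' hcut' => ?_⟩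
      have := (Nat.find_spec hex).1
      exact Nat.find_min hex ht' ⟨by omega, hcut'⟩
    obtain ⟨l₁, l₂, hl, hl₁⟩ := hcut
    obtain ⟨m₁, m₂, hm, hm₁⟩ := hfwd t ht ⟨l₁, l₂, hl, hl₁⟩
    have hl₂ : l₂.flatMap h = X.drop t ++ (X ++ Z) := by
      rw [← hd₁ t (by omega), ← hl₁, hl, List.flatMap_append, List.drop_left]
    have hm₂ : m₂.flatMap h = X.drop t ++ Z := by
      rw [← hd₂ t (by omega), ← hm₁, hm, List.flatMap_append, List.drop_left]
    obtain ⟨c, l', m', W', rfl, rfl, hW, hWl, hWm, hzl, hzm⟩ :=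
      exists_common_letters H.length_pos H.eq_of_prefix l₂ m₂ (X.drop t)
        (hl₂ ▸ List.prefix_append _ _) (hm₂ ▸ List.prefix_append _ _)
    have hWlen := congrArg List.length hW
    simp only [List.length_drop, List.length_append] at hWlen
    obtain ⟨d, rfl⟩ : l₁ ++ c <+: m₁ := by
      rcases List.prefix_or_prefix_of_prefix (l₃ := ls) (l₁ := l₁ ++ c) (l₂ := m₁)
        ⟨l', by rw [hl, List.append_assoc]⟩ ⟨c ++ m', hm.symm⟩ with h₁ | ⟨e, he⟩
      · exact h₁
      · have h₂ := congrArg (fun l => (l.flatMap h).length) he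
        simp only [List.flatMap_append, List.length_append] at h₂
        obtain rfl : e = [] := by
          cases e with
          | nil => rfl
          | cons x e =>
            have := H.length_pos x
            rw [List.flatMap_cons, List.length_append] at h₂
            omega
        exact ⟨[], by simpa using he.symm⟩
    simp only [List.flatMap_append, List.length_append] at hm₁
    obtain rfl : l' = d ++ (c ++ m') := by
      have := hl.symm.trans hm
      simpa using this
    cases d with
    | nil =>
      obtain rfl := hsq l₁ c c m' (by rw [hl]; simp) rfl
      simp only [List.flatMap_nil, List.length_nil] at hm₁
      omega
    | cons z d =>
      have hz : W'.length < (h z).length := hzl z (by simp)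
      rw [List.flatMap_cons, List.length_append] at hm₁
      cases d with
      | cons z₁ d =>
        have hz₁ := H.length_pos z₁
        rw [List.flatMap_cons, List.length_append] at hm₁
        set t' := (l₁.flatMap h).length + (c.flatMap h).length + (h z).length
          - (U.length + X.length) with ht'
        refine absurd (hbwd t' (by omega) ⟨l₁ ++ c ++ [z], z₁ :: d ++ (c ++ m'), ?_, ?_⟩)
          (hmin t' (by omega))
        · rw [hl]; simp
        · simp only [List.flatMap_append, List.length_append, List.flatMap_singleton]
          omega
      | nil =>
        rw [List.flatMap_nil, List.length_nil] at hm₁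
        have hNz := H.le_length z
        have hpq := H.add_le
        have hW'z : W' <+: h z := by
          refine List.prefix_of_prefix_length_le hWl ?_ hz.le
          simp
        by_cases hq : q ≤ W'.length
        · cases m' with
          | nil =>
            have hq₀ := H.q_pos
            have := hWm.length_le
            rw [List.flatMap_nil, List.length_nil] at this
            omega
          | cons z' m' =>
            have hz' : W' <+: h z' := by
              refine List.prefix_of_prefix_length_le hWm ?_ (hzm z' (by simp)).le
              simp
            have hlab := H.label_eq_of_prefix z z' W' hq hW'z hz'
            have := hsq l₁ (c ++ [z]) (c ++ [z']) m' (by rw [hl]; simp) (by simp [hlab])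
            simp at this
        · have hp := H.p_pos
          have htp : p ≤ t := by omega
          have hpref₁ : l₁.flatMap h = U ++ X.take t := by
            have h₁ : l₁.flatMap h <+: ls.flatMap h := by rw [hl]; simp
            have h₂ : U ++ X.take t <+: ls.flatMap h := by
              rw [← hT, List.append_assoc, List.prefix_append_right_inj, List.append_assoc]
              exact (List.take_prefix _ _).trans (List.prefix_append _ _)
            refine (List.prefix_of_prefix_length_le h₁ h₂ ?_).eq_of_length ?_ <;>
            · simp only [List.length_append, List.length_take]
              omega
          have hpref₂ : (l₁ ++ c ++ [z]).flatMap h = U ++ X ++ X.take t := by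
            have h₁ : (l₁ ++ c ++ [z]).flatMap h <+: ls.flatMap h := by rw [hl]; simp
            have h₂ : U ++ X ++ X.take t <+: ls.flatMap h := by
              rw [← hT, ← List.append_assoc, List.append_assoc _ X Z,
                List.prefix_append_right_inj]
              exact (List.take_prefix _ _).trans (List.prefix_append _ _)
            refine (List.prefix_of_prefix_length_le h₁ h₂ ?_).eq_of_length ?_ <;>
            · simp only [List.length_append, List.length_take, List.flatMap_append,
                List.flatMap_singleton]
              omega
          have hsz : X.take t <:+ h z := by
            refine List.suffix_of_suffix_length_le (l₃ := U ++ X ++ X.take t)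
              (List.suffix_append _ _) ?_ ?_
            · rw [← hpref₂, List.flatMap_append, List.flatMap_singleton]
              exact List.suffix_append _ _
            · rw [List.length_take]; omega
          rcases List.eq_nil_or_concat l₁ with rfl | ⟨l₁', y, rfl⟩
          · rw [List.flatMap_nil, List.length_nil] at hl₁
            omega
          · rw [List.concat_eq_append] at *
            have hy : t < (h y).length := by
              by_contra hy
              rw [List.flatMap_append, List.length_append, List.flatMap_singleton] at hl₁
              have hypos := H.length_pos y
              exact hmin (t - (h y).length) (by omega)
                ⟨l₁', _, hl.trans (List.append_assoc _ _ _), by omega⟩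
            have hsy : X.take t <:+ h y := by
              refine List.suffix_of_suffix_length_le (l₃ := U ++ X.take t)
                (List.suffix_append _ _) ?_ ?_
              · rw [← hpref₁]; simp
              · rw [List.length_take]; omega
            have hlab := H.label_eq_of_suffix y z (X.take t)
              (by rw [List.length_take]; omega) hsy hsz
            have := hsq l₁' ([y] ++ c) ([z] ++ c) m' (by rw [hl]; simp) (by simp [hlab])
            simp at this
  · obtain ⟨u, hu, hu3, hXu⟩ := H.exists_short_infix hX hT.symm fun t ht =>
      ⟨fun hcut => hex ⟨t, ht, hcut⟩, fun hcut => hex ⟨t, ht, hbwd t ht hcut⟩⟩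
    exact H.squareFree_short u hu3 (hc.infix hu) X hX hXu

end IsSyncCode

end SyncCode

section WordCode

/-- The word `w` read as a number in base four, first letter least significant. -/
def code : List (Fin 3) → ℕ
  | [] => 0
  | x :: w => x.val + 4 * code w

theorem code_append (u v : List (Fin 3)) : code (u ++ v) = code u + 4 ^ u.length * code v := by
  induction u with
  | nil => simp [code]
  | cons x u ih => simp only [List.cons_append, code, ih, List.length_cons, pow_succ]; ring

theorem code_lt (u : List (Fin 3)) : code u < 4 ^ u.length := by
  induction u with
  | nil => simp [code]
  | cons x u ih => simp only [code, List.length_cons, pow_succ]; omega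

theorem code_append_mod (u v : List (Fin 3)) : code (u ++ v) % 4 ^ u.length = code u := by
  rw [code_append, Nat.add_mul_mod_self_left, Nat.mod_eq_of_lt (code_lt u)]

theorem code_append_shiftRight (u v : List (Fin 3)) :
    code (u ++ v) >>> (2 * u.length) = code v := by
  rw [Nat.shiftRight_eq_div_pow, pow_mul, show 2 ^ 2 = 4 by rfl, code_append,
    Nat.add_mul_div_left _ _ (by positivity),
    Nat.div_eq_of_lt (code_lt u), zero_add]

theorem code_take (w : List (Fin 3)) {k : ℕ} (hk : k ≤ w.length) :
    code (w.take k) = code w % 4 ^ k := by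
  have := code_append_mod (w.take k) (w.drop k)
  rwa [List.take_append_drop, List.length_take_of_le hk, eq_comm] at this

theorem code_drop (w : List (Fin 3)) {k : ℕ} (hk : k ≤ w.length) :
    code (w.drop k) = code w >>> (2 * k) := by
  have := code_append_shiftRight (w.take k) (w.drop k)
  rwa [List.take_append_drop, List.length_take_of_le hk, eq_comm] at this

theorem code_injective {u v : List (Fin 3)} (hl : u.length = v.length) (h : code u = code v) :
    u = v := by
  induction u generalizing v with
  | nil => exact (List.length_eq_zero_iff.1 hl.symm).symm
  | cons x u ih =>
    cases v with
    | nil => simp at hl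
    | cons y v =>
      simp only [code] at h
      rw [ih (by simpa using hl) (by omega), Fin.ext (show x.val = y.val by omega)]

/-- If `D` has `s` consecutive zero bits starting at position `j`, then bit `j` of the result
vanishes. -/
def smear : ℕ → ℕ → ℕ → ℕ
  | 0, D, _ => D
  | fuel + 1, D, s =>
    bif s.ble 1 then D else smear fuel (D.lor (D.shiftRight (s.div 2))) (s.sub (s.div 2))

theorem testBit_smear (fuel D s j : ℕ) (hs : 0 < s)
    (hD : ∀ i, i < s → D.testBit (j + i) = false) : (smear fuel D s).testBit j = false := by
  induction fuel generalizing D s with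
  | zero => exact hD 0 hs
  | succ fuel ih =>
    rw [smear, cond_eq_ite]
    split_ifs with h
    · exact hD 0 hs
    · have h' : ¬ s ≤ 1 := fun h₁ => h (Nat.ble_eq_true_of_le h₁)
      have hsub : s.sub (s.div 2) = s - s / 2 := rfl
      rw [hsub]
      refine ih _ _ (by omega) fun i hi => ?_
      change (D ||| D >>> (s / 2)).testBit (j + i) = false
      rw [Nat.testBit_or, Nat.testBit_shiftRight, hD i (by omega), Bool.false_or,
        show s / 2 + (j + i) = j + (i + s / 2) by omega]
      exact hD _ (by omega)

/-- The number whose binary digits at the even positions below `2 * t` are one. -/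
def evenBits (t : ℕ) : ℕ := Nat.div (Nat.sub (Nat.pow 4 t) 1) 3

theorem testBit_evenBits (t j : ℕ) (h : j < t) : (evenBits t).testBit (2 * j) = true := by
  change ((4 ^ t - 1) / 3).testBit (2 * j) = true
  induction t generalizing j with
  | zero => omega
  | succ t ih =>
    have h4 : 0 < 4 ^ t := by positivity
    have h3 : (4 ^ (t + 1) - 1) / 3 = 4 * ((4 ^ t - 1) / 3) + 1 := by
      have : (4 ^ t - 1) % 3 = 0 := by
        have := Nat.ModEq.pow t (show 4 ≡ 1 [MOD 3] by decide)
        rw [one_pow, Nat.ModEq] at this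
        omega
      rw [pow_succ]
      omega
    rw [h3]
    cases j with
    | zero => rw [Nat.mul_zero, Nat.testBit_zero]; simp only [decide_eq_true_eq]; omega
    | succ j =>
      rw [← ih j (by omega), show 2 * (j + 1) = 2 * j + 1 + 1 by ring, Nat.testBit_succ,
        Nat.testBit_succ]
      congr 1
      omega

/-- No square with period at most `k` occurs in the word of length `n` with code `X`. -/
def noSquareUpTo (X n : ℕ) : ℕ → Bool
  | 0 => true
  | k + 1 =>
    bif ((smear 8 (X.xor (X.shiftRight (2 * (k + 1)))) (2 * (k + 1))).land
      (evenBits (Nat.sub (n + 1) (2 * (k + 1))))).beq (evenBits (Nat.sub (n + 1) (2 * (k + 1))))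
    then noSquareUpTo X n k else false

theorem noSquareUpTo_spec {w x : List (Fin 3)} {k : ℕ} (h : noSquareUpTo (code w) w.length k)
    (hx : x ≠ []) (hk : x.length ≤ k) : ¬ (x ++ x) <:+: w := by
  induction k with
  | zero => exact absurd (List.length_eq_zero_iff.1 (by omega)) hx
  | succ k ih =>
    rw [noSquareUpTo, cond_eq_ite] at h
    split_ifs at h with h₁
    by_cases hxk : x.length ≤ k
    · exact ih h hxk
    have hxk' : x.length = k + 1 := by omega
    rintro ⟨s, t, rfl⟩
    have h₂ := congrArg (Nat.testBit · (2 * s.length)) (Nat.eq_of_beq_eq_true h₁)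
    change (smear 8 (_ ^^^ _ >>> _) _ &&& evenBits (_ - _)).testBit _ =
      (evenBits (_ - _)).testBit _ at h₂
    rw [Nat.testBit_and, testBit_evenBits _ _ (by
      simp only [List.length_append]; omega), Bool.and_true, testBit_smear _ _ _ _ (by omega)] at h₂
    · exact Bool.false_ne_true h₂
    intro i hi
    have e₁ : code (s ++ (x ++ x) ++ t) >>> (2 * s.length) % 4 ^ x.length = code x := by
      rw [List.append_assoc, code_append_shiftRight, List.append_assoc, code_append_mod]
    have e₂ : code (s ++ (x ++ x) ++ t) >>> (2 * (s ++ x).length) % 4 ^ x.length = code x := by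
      rw [← List.append_assoc s, List.append_assoc (s ++ x), code_append_shiftRight,
        code_append_mod]
    have e₃ := congrArg (Nat.testBit · i) (e₁.trans e₂.symm)
    rw [show 4 ^ x.length = 2 ^ (2 * x.length) by rw [pow_mul]; rfl] at e₃
    simp only [Nat.testBit_mod_two_pow, Nat.testBit_shiftRight, hxk', hi, decide_true,
      Bool.true_and, List.length_append] at e₃
    rw [Nat.testBit_xor, Nat.testBit_shiftRight, e₃, bne_eq_false_iff_eq]
    congr 1
    ring

/-- A test for square-freeness. -/
def freeCheck (w : List (Fin 3)) : Bool :=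
  noSquareUpTo (code w) w.length (w.length.div 2)

theorem squareFree_of_freeCheck {w : List (Fin 3)} (h : freeCheck w) : SquareFree w := by
  intro x hx hs
  refine noSquareUpTo_spec h hx ?_ hs
  have := hs.length_le
  rw [List.length_append] at this
  change x.length ≤ w.length / 2
  omega

/-- The word with code `X` has a square of period `k` at position `i`. -/
def squareAt (X n k i : ℕ) : Bool :=
  bif Nat.ble (i + 2 * k) n then
    Nat.beq ((X.shiftRight (2 * i)).mod (Nat.pow 4 k))
      ((X.shiftRight (2 * (i + k))).mod (Nat.pow 4 k))
  else false

theorem not_squareFree_of_squareAt {w : List (Fin 3)} {k i : ℕ} (hk : 0 < k)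
    (h : squareAt (code w) w.length k i) : ¬ SquareFree w := by
  rw [squareAt, cond_eq_ite] at h
  split_ifs at h with hn
  have hn' := Nat.le_of_ble_eq_true hn
  have h' : (code w >>> (2 * i)) % 4 ^ k = (code w >>> (2 * (i + k))) % 4 ^ k :=
    Nat.eq_of_beq_eq_true h
  rw [← code_drop w (by omega), ← code_drop w (by omega),
    ← code_take _ (by rw [List.length_drop]; omega),
    ← code_take _ (by rw [List.length_drop]; omega)] at h'
  have he := code_injective (by simp only [List.length_take, List.length_drop]; omega) h'
  intro hw
  refine hw ((w.drop i).take k) ?_ ⟨w.take i, w.drop (i + k + k), ?_⟩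
  · rw [← List.length_pos_iff, List.length_take, List.length_drop]; omega
  · nth_rewrite 2 [he]
    rw [List.append_assoc, List.append_assoc, ← List.drop_drop (i := k) (j := i + k),
      List.take_append_drop,
       ← List.drop_drop (i := k) (j := i), List.take_append_drop, List.take_append_drop]

/-- Inserting any letter at position `o` of the word `w` creates a square. -/
def blockedAt (w : List (Fin 3)) (o : ℕ) : Bool :=
  [0, 1, 2].all fun x =>
    [1, 2, 3, 4, 6, 8, 11, 12, 13, 21, 23].any fun k => (List.range (2 * k)).any fun d =>
      squareAt ((code w).mod (Nat.pow 4 o) +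
        Nat.pow 4 o * (x + 4 * (code w).shiftRight (2 * o))) (w.length + 1) k (o - d)

theorem not_squareFree_of_blockedAt {u v : List (Fin 3)} (h : blockedAt (u ++ v) u.length)
    (x : Fin 3) : ¬ SquareFree (u ++ [x] ++ v) := by
  have hx : x.val ∈ [0, 1, 2] := by fin_cases x <;> simp
  have h' := List.all_eq_true.1 h _ hx
  have hY : Nat.mod (code (u ++ v)) (Nat.pow 4 u.length) + Nat.pow 4 u.length *
      (x.val + 4 * Nat.shiftRight (code (u ++ v)) (2 * u.length)) = code (u ++ [x] ++ v) := by
    change code (u ++ v) % 4 ^ u.length + 4 ^ u.length *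
      (x.val + 4 * code (u ++ v) >>> (2 * u.length)) = _
    rw [code_append_mod, code_append_shiftRight, List.append_assoc, code_append]
    rfl
  rw [hY] at h'
  obtain ⟨k, hk, h'⟩ := List.any_eq_true.1 h'
  obtain ⟨d, -, h'⟩ := List.any_eq_true.1 h'
  refine not_squareFree_of_squareAt (k := k) (i := u.length - d) ?_ ?_
  · simp only [List.mem_cons, List.not_mem_nil, or_false] at hk; omega
  · convert h' using 2
    simp only [List.length_append, List.length_singleton]; omega

end WordCode
section Blocks

/-- The four kinds of blocks from which the words are built. -/
inductive Block
  | short | long | pre | suf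
  deriving DecidableEq

/-- The unpermuted word of a block. -/
def blockBase (m : Bool) : Block → List (Fin 3)
  | .short => Qw
  | .long => Rw
  | .pre => if m then Sw else Pw
  | .suf => if m then Pw else Sw

/-- The word of a block at a vertex. -/
def image (a : V × Block) : List (Fin 3) := applyV a.1 (blockBase a.1.2 a.2)

/-- The letter of `D̂` whose image under `δ` contains the given block. -/
def label : V × Block → Vhat
  | (v, .short) => Sum.inl v
  | (v, .long) => Sum.inl v
  | (v, .pre) => Sum.inr (v, false)
  | (v, .suf) => Sum.inr (v, true)

/-- The out-neighbours of a vertex of `D`. -/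
def outNbrs (v : V) : List V :=
  if v.2 then [(v.1 * pac, false), (v.1 * pbc, true)]
  else [(v.1 * pab, true), (v.1 * pbc, false)]

/-- The blocks that may follow a block. -/
def nextBlocks (a : V × Block) : List (V × Block) :=
  match a.2 with
  | .pre => [(a.1, .short), (a.1, .long)]
  | .suf => []
  | _ => (a.1, .suf) :: (outNbrs a.1).flatMap fun w => [(w, .short), (w, .long)]

/-- The blocks at the vertices with a given permutation. -/
def blocksAt (σ : Equiv.Perm (Fin 3)) : List (V × Block) :=
  [false, true].flatMap fun m => [Block.short, .long, .pre, .suf].map fun k => ((σ, m), k)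

/-- All permutations of the three letters. -/
def allPerms : List (Equiv.Perm (Fin 3)) := [pid, pab, pac, pbc, pabc, pacb]

theorem mem_allPerms (σ : Equiv.Perm (Fin 3)) : σ ∈ allPerms := by
  revert σ; decide +kernel

theorem arc_iff (x y : V) : Arc x y ↔ y ∈ outNbrs x := by
  revert x y; unfold Arc; decide +kernel

/-- All blocks. -/
def allBlocks : List (V × Block) := allPerms.flatMap blocksAt

/-- The image of every chain of at most three blocks starting with `a` is square-free. -/
def chainCheck (a : V × Block) : Bool :=
  freeCheck (image a) && (nextBlocks a).all fun b =>
    freeCheck (image a ++ image b) && (nextBlocks b).all fun c =>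
      freeCheck (image a ++ image b ++ image c)

/-- No block occurs, up to its first 42 letters, at one of the positions `1, …, r` of `w`. -/
def offsetCheck (w : List (Fin 3)) (r : ℕ) : Bool :=
  allBlocks.all fun c => (List.range r).all fun o =>
    !(((code w).shiftRight (2 * (o + 1))).mod (Nat.pow 4 (min 42 (image c).length))).beq
      ((code (image c)).mod (Nat.pow 4 (min 42 (image c).length)))

/-- No block starts inside `a`, whether or not `a` is followed by another block. -/
def syncCheck (a : V × Block) : Bool :=
  offsetCheck (image a) ((image a).length - 42) && (nextBlocks a).all fun b =>
    offsetCheck (image a ++ image b) ((image a).length - 1)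

/-- Blocks with labels other than that of `a` differ from `a` in their first 21 and in their
last 21 letters, and `a` is not a prefix of another block. -/
def labelCheck (a : V × Block) : Bool :=
  allBlocks.all fun c =>
    (decide (a = c) ||
      !((code (image c)).mod (Nat.pow 4 (image a).length)).beq (code (image a))) &&
    (decide (label a = label c) ||
      !((code (image a)).mod (Nat.pow 4 21)).beq ((code (image c)).mod (Nat.pow 4 21)) &&
      !((code (image a)).shiftRight (2 * ((image a).length - 21))).beq
        ((code (image c)).shiftRight (2 * ((image c).length - 21))))

/-- Insertions into a block are blocked by the block and one neighbour. -/
def extremalCheck (a : V × Block) : Bool :=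
  (nextBlocks a).all fun b =>
    ((List.range (image b).length).all fun o =>
      blockedAt (image a ++ image b) ((image a).length + o)) &&
    (decide (b.2 ≠ .suf) ||
      blockedAt (image a ++ image b) ((image a).length + (image b).length)) &&
    (decide (a.2 ≠ .pre) ||
      (List.range (image a).length).all fun o => blockedAt (image a ++ image b) o)

theorem chainCheck_all : (blocksAt 1).all chainCheck = true := by
  decide +kernel

theorem syncCheck_all : (blocksAt 1).all syncCheck = true := by
  decide +kernel

theorem labelCheck_all : (blocksAt 1).all labelCheck = true := by
  decide +kernel

theorem extremalCheck_all : (blocksAt 1).all extremalCheck = true := by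
  decide +kernel

theorem mem_allBlocks (a : V × Block) : a ∈ allBlocks := by
  obtain ⟨⟨σ, m⟩, k⟩ := a
  refine List.mem_flatMap.2 ⟨σ, mem_allPerms σ, ?_⟩
  cases m <;> cases k <;> simp [blocksAt]

/-- The arc relation of `D̂`, on blocks. -/
def BlockArc (a b : V × Block) : Prop := ArcHat (label a) (label b)

theorem BlockArc.mem_nextBlocks {a b : V × Block} (h : BlockArc a b) : b ∈ nextBlocks a := by
  obtain ⟨v, k⟩ := a
  obtain ⟨w, l⟩ := b
  cases k <;> cases l <;> simp_all [BlockArc, label, ArcHat, nextBlocks, arc_iff]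

/-- Permuting the letters of a block. -/
def act (σ : Equiv.Perm (Fin 3)) (a : V × Block) : V × Block := ((σ * a.1.1, a.1.2), a.2)

theorem image_act (σ : Equiv.Perm (Fin 3)) (a : V × Block) :
    image (act σ a) = (image a).map σ := by
  obtain ⟨⟨τ, m⟩, k⟩ := a
  cases m <;> simp [image, act, applyV, Function.comp_def]

theorem act_injective (σ : Equiv.Perm (Fin 3)) : Function.Injective (act σ) := by
  rintro ⟨⟨τ, m⟩, k⟩ ⟨⟨τ', m'⟩, k'⟩ h
  simpa [act] using h

theorem label_eq_of_act {σ : Equiv.Perm (Fin 3)} {a b : V × Block}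
    (h : label (act σ a) = label (act σ b)) : label a = label b := by
  obtain ⟨⟨τ, m⟩, k⟩ := a
  obtain ⟨⟨τ', m'⟩, k'⟩ := b
  cases k <;> cases k' <;> simp_all [label, act]

theorem act_mem_nextBlocks (σ : Equiv.Perm (Fin 3)) {a b : V × Block} (h : b ∈ nextBlocks a) :
    act σ b ∈ nextBlocks (act σ a) := by
  obtain ⟨⟨τ, m⟩, k⟩ := a
  cases k <;> cases m <;> simp only [nextBlocks, outNbrs] at h ⊢ <;>
    simp only [List.mem_cons, List.mem_flatMap, List.not_mem_nil, or_false, if_true, if_false,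
      Bool.false_eq_true, exists_eq_or_imp, exists_eq_left, act] at h ⊢ <;>
    casesm* _ ∨ _ <;> subst_vars <;> simp [mul_assoc]

theorem act_inv_mem_blocksAt (a : V × Block) : act a.1.1⁻¹ a ∈ blocksAt 1 := by
  obtain ⟨⟨σ, m⟩, k⟩ := a
  cases m <;> cases k <;> simp [blocksAt, act]

theorem Incomparable.of_map {α β : Type*} (f : α → β) {u v : List α}
    (h : Incomparable (u.map f) (v.map f)) : Incomparable u v :=
  ⟨fun h' => h.1 (h'.map f), fun h' => h.2 (h'.map f)⟩

theorem squareFree_of_map_act (σ : Equiv.Perm (Fin 3)) {ls : List (V × Block)}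
    (h : SquareFree ((ls.map (act σ)).flatMap image)) : SquareFree (ls.flatMap image) := by
  refine SquareFree.of_map σ ?_
  rwa [List.map_flatMap, List.flatMap_congr (g := fun a => image (act σ a))
    (fun a _ => (image_act σ a).symm), ← List.flatMap_map]

theorem squareFree_flatMap_image {ls : List (V × Block)} (hl : ls.length ≤ 3)
    (hc : ls.IsChain BlockArc) : SquareFree (ls.flatMap image) := by
  cases ls with
  | nil => intro x hx hs; simp_all
  | cons a ls =>
    refine squareFree_of_map_act a.1.1⁻¹ ?_
    have ha := List.all_eq_true.1 chainCheck_all _ (act_inv_mem_blocksAt a)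
    simp only [chainCheck, Bool.and_eq_true, List.all_eq_true] at ha
    obtain ⟨h₁, h₂⟩ := ha
    match ls, hc with
    | [], _ => simpa using squareFree_of_freeCheck h₁
    | [b], hc =>
      simp only [List.isChain_cons_cons] at hc
      have h₃ := h₂ _ (act_mem_nextBlocks _ hc.1.mem_nextBlocks)
      simpa using squareFree_of_freeCheck h₃.1
    | [b, c], hc =>
      simp only [List.isChain_cons_cons] at hc
      have h₃ := (h₂ _ (act_mem_nextBlocks _ hc.1.mem_nextBlocks)).2 _
        (act_mem_nextBlocks _ hc.2.1.mem_nextBlocks)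
      simpa using squareFree_of_freeCheck h₃
    | _ :: _ :: _ :: _, _ => simp only [List.length_cons] at hl; omega

theorem incomparable_of_offsetCheck {w : List (Fin 3)} {r o : ℕ} (h : offsetCheck w r)
    (c : V × Block) (ho : 0 < o) (hor : o ≤ r) (hw : o + 42 ≤ w.length) :
    Incomparable ((w.drop o).take 42) (image c) := by
  have h₁ := List.all_eq_true.1 (List.all_eq_true.1 h c (mem_allBlocks c)) (o - 1)
    (List.mem_range.2 (by omega))
  rw [Nat.sub_add_cancel (by omega), Bool.not_eq_true'] at h₁
  replace h₁ := Nat.ne_of_beq_eq_false h₁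
  change (code w) >>> (2 * o) % 4 ^ (min 42 _) ≠ code (image c) % 4 ^ (min 42 _) at h₁
  rw [← code_drop w (by omega), ← code_take _ (by rw [List.length_drop]; omega),
    ← code_take _ (by omega)] at h₁
  have hl : ((w.drop o).take 42).length = 42 := by
    rw [List.length_take, List.length_drop]; omega
  refine ⟨fun ⟨t, ht⟩ => h₁ ?_, fun ⟨t, ht⟩ => h₁ ?_⟩
  · rw [← ht, List.take_append_of_le_length (by omega), List.take_take]
    congr 2
    omega
  · have := congrArg (List.take (min 42 (image c).length)) ht
    rw [List.take_append_of_le_length (by omega), List.take_take] at this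
    rw [this]
    congr 2
    omega

theorem image_length (a : V × Block) : 41 ≤ (image a).length := by
  obtain ⟨⟨σ, m⟩, k⟩ := a
  cases k <;> cases m <;> simp [image, applyV, blockBase, Qw, Rw, Pw, Sw]

theorem code_conditions (a c : V × Block) (σ : Equiv.Perm (Fin 3)) (hσ : σ = a.1.1⁻¹) :
    (a = c ∨ code ((image c).map σ) % 4 ^ (image a).length ≠ code ((image a).map σ)) ∧
    (label a = label c ∨
      code (((image a).map σ).take 21) ≠ code (((image c).map σ).take 21) ∧
      code (((image a).map σ).drop ((image a).length - 21)) ≠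
        code (((image c).map σ).drop ((image c).length - 21))) := by
  have h := List.all_eq_true.1 (List.all_eq_true.1 labelCheck_all _ (act_inv_mem_blocksAt a))
    (act σ c) (mem_allBlocks _)
  rw [← hσ] at h
  simp only [image_act, List.length_map, Bool.and_eq_true, Bool.or_eq_true, decide_eq_true_eq,
    Bool.not_eq_true', (act_injective σ).eq_iff] at h
  have ha := image_length a
  have hc := image_length c
  refine ⟨h.1.imp_right Nat.ne_of_beq_eq_false, h.2.imp label_eq_of_act fun h' => ?_⟩
  rw [code_take _ (by rw [List.length_map]; omega), code_take _ (by rw [List.length_map]; omega),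
    code_drop _ (by rw [List.length_map]; omega), code_drop _ (by rw [List.length_map]; omega)]
  exact ⟨Nat.ne_of_beq_eq_false h'.1, Nat.ne_of_beq_eq_false h'.2⟩

theorem isSyncCode_image : IsSyncCode BlockArc label image 41 21 21 where
  p_pos := by norm_num
  q_pos := by norm_num
  add_le := by norm_num
  le_length := image_length
  eq_of_prefix a c h := by
    refine (code_conditions a c _ rfl).1.resolve_right fun h₂ => h₂ ?_
    obtain ⟨t, ht⟩ := h.map (a.1.1⁻¹ : Equiv.Perm (Fin 3))
    rw [← ht]
    simpa using code_append_mod ((image a).map (a.1.1⁻¹ : Equiv.Perm (Fin 3))) t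
  label_eq_of_prefix a c u hu ha hc := by
    refine (code_conditions a c _ rfl).2.resolve_right fun h₂ => h₂.1 ?_
    obtain ⟨t, ht⟩ := ha
    obtain ⟨t', ht'⟩ := hc
    rw [← List.map_take, ← List.map_take, ← ht, ← ht', List.take_append_of_le_length hu,
      List.take_append_of_le_length hu]
  label_eq_of_suffix a c u hu ha hc := by
    refine (code_conditions a c _ rfl).2.resolve_right fun h₂ => h₂.2 ?_
    obtain ⟨t, ht⟩ := ha
    obtain ⟨t', ht'⟩ := hc
    rw [← List.map_drop, ← List.map_drop, ← ht, ← ht', List.length_append, List.length_append,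
      Nat.add_sub_assoc hu, Nat.add_sub_assoc hu, List.drop_length_add_append,
      List.drop_length_add_append]
  sync_single a c o ho hol := by
    have h₁ := List.all_eq_true.1 syncCheck_all _ (act_inv_mem_blocksAt a)
    rw [syncCheck, Bool.and_eq_true] at h₁
    refine Incomparable.of_map (a.1.1⁻¹ : Equiv.Perm (Fin 3)) ?_
    have hl : (image (act a.1.1⁻¹ a)).length = (image a).length := by simp [image_act]
    rw [List.map_take, List.map_drop, ← image_act, ← image_act]
    exact incomparable_of_offsetCheck h₁.1 _ ho (by omega) (by omega)
  sync_pair a b c o hE ho hoa := by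
    have h₁ := List.all_eq_true.1 syncCheck_all _ (act_inv_mem_blocksAt a)
    rw [syncCheck, Bool.and_eq_true] at h₁
    have h₂ := List.all_eq_true.1 h₁.2 _ (act_mem_nextBlocks _ hE.mem_nextBlocks)
    refine Incomparable.of_map (a.1.1⁻¹ : Equiv.Perm (Fin 3)) ?_
    have hl : (image (act a.1.1⁻¹ a)).length = (image a).length := by simp [image_act]
    have hb := image_length (act a.1.1⁻¹ b)
    rw [List.map_take, List.map_append, List.map_drop, ← image_act, ← image_act, ← image_act,
      ← List.drop_append_of_le_length (by omega)]
    exact incomparable_of_offsetCheck h₂ _ ho (by omega) (by rw [List.length_append]; omega)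
  squareFree_short u hu hc := squareFree_flatMap_image hu hc

/-- Every letter inserted into the image of `[a, b]` inside `b`, or inside an initial block `a`,
or after a final block `b`, creates a square. -/
theorem BlockArc.not_squareFree_insert {a b : V × Block} (h : BlockArc a b)
    {u v : List (Fin 3)} (huv : image a ++ image b = u ++ v)
    (hu : (image a).length ≤ u.length ∧ v ≠ [] ∨ b.2 = .suf ∧ v = [] ∨
      a.2 = .pre ∧ u.length < (image a).length) (x : Fin 3) :
    ¬ SquareFree (u ++ [x] ++ v) := by
  set σ := a.1.1⁻¹ with hσ
  have h₁ := List.all_eq_true.1 (List.all_eq_true.1 extremalCheck_all _ (act_inv_mem_blocksAt a))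
    _ (act_mem_nextBlocks σ h.mem_nextBlocks)
  rw [← hσ, image_act, image_act, ← List.map_append, huv, List.map_append] at h₁
  simp only [Bool.and_eq_true, Bool.or_eq_true, decide_eq_true_eq, List.all_eq_true,
    List.mem_range, List.length_map] at h₁
  have hl : (image a).length + (image b).length = u.length + v.length := by
    rw [← List.length_append, huv, List.length_append]
  have h₂ : blockedAt (u.map σ ++ v.map σ) (u.map σ).length = true := by
    rw [List.length_map]
    rcases hu with ⟨hu, hv⟩ | ⟨hb, hv⟩ | ⟨ha, hu⟩
    · have := List.length_pos_iff.2 hv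
      have h₃ := h₁.1.1 (u.length - (image a).length) (by omega)
      rwa [Nat.add_sub_cancel' hu] at h₃
    · have h₃ := h₁.1.2.resolve_left (not_not.2 hb)
      subst hv
      rwa [hl, List.length_nil, Nat.add_zero] at h₃
    · exact h₁.2.resolve_left (not_not.2 ha) _ hu
  intro h₃
  refine not_squareFree_of_blockedAt h₂ (σ x) ?_
  simpa using h₃.map σ.injective

theorem exists_eq_append_of_append_eq {α : Type*} {s m t w w' : List α}
    (h : s ++ (m ++ t) = w ++ w') (h₁ : s.length ≤ w.length)
    (h₂ : w.length ≤ s.length + m.length) :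
    ∃ u v, w = s ++ u ∧ w' = v ++ t ∧ m = u ++ v := by
  obtain ⟨u, rfl⟩ := List.prefix_of_prefix_length_le ⟨_, h⟩ ⟨_, rfl⟩ h₁
  rw [List.append_assoc, List.append_cancel_left_eq] at h
  rw [List.length_append, Nat.add_le_add_iff_left] at h₂
  obtain ⟨v, rfl⟩ := List.prefix_of_prefix_length_le ⟨_, h.symm⟩ ⟨_, rfl⟩ h₂
  rw [List.append_assoc, List.append_cancel_left_eq] at h
  exact ⟨u, v, rfl, h.symm, rfl⟩

/-- Inserting a letter into the image of a complete chain of blocks creates a square. -/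
theorem not_squareFree_insert {x y : V} {ls : List (V × Block)} (hne : ls ≠ [])
    (hc : ((x, Block.pre) :: ls ++ [(y, Block.suf)]).IsChain BlockArc) {w w' : List (Fin 3)}
    (hw : ((x, Block.pre) :: ls ++ [(y, Block.suf)]).flatMap image = w ++ w') (c : Fin 3) :
    ¬ SquareFree (w ++ [c] ++ w') := by
  have key : ∀ l₁ a b l₂, (x, Block.pre) :: ls ++ [(y, Block.suf)] = l₁ ++ a :: b :: l₂ →
      (l₁.flatMap image).length ≤ w.length →
      w.length ≤ (l₁.flatMap image).length + (image a ++ image b).length →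
      ((l₁.flatMap image).length + (image a).length ≤ w.length ∧
        w.length < (l₁.flatMap image).length + (image a ++ image b).length ∨
        b.2 = .suf ∧ w.length = (l₁.flatMap image).length + (image a ++ image b).length ∨
        a.2 = .pre ∧ w.length < (l₁.flatMap image).length + (image a).length) →
      ¬ SquareFree (w ++ [c] ++ w') := by
    intro l₁ a b l₂ hl h₁ h₂ h₃
    rw [hl] at hw hc
    rw [List.flatMap_append, List.flatMap_cons, List.flatMap_cons, ← List.append_assoc (image a)]
      at hw
    obtain ⟨u, v, rfl, rfl, huv⟩ := exists_eq_append_of_append_eq hw h₁ h₂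
    have hab : BlockArc a b := (List.isChain_cons_cons.1 (List.isChain_append.1 hc).2.1).1
    rw [huv] at h₃
    simp only [List.length_append] at h₃
    intro hsf
    refine hab.not_squareFree_insert huv ?_ c (hsf.of_infix ⟨l₁.flatMap image,
      l₂.flatMap image, by simp⟩)
    rw [← List.length_pos_iff, ← List.length_eq_zero_iff]
    rcases h₃ with h₃ | h₃ | h₃
    · exact .inl (by omega)
    · exact .inr (.inl ⟨h₃.1, by omega⟩)
    · exact .inr (.inr ⟨h₃.1, by omega⟩)
  have hlen := congrArg List.length hw
  rw [List.length_append] at hlen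
  rcases Nat.eq_zero_or_pos w'.length with hw' | hw'
  · obtain ⟨l, a, rfl⟩ := (List.eq_nil_or_concat ls).resolve_left hne
    refine key ((x, Block.pre) :: l) a (y, Block.suf) [] (by simp) ?_ ?_ (.inr (.inl ⟨rfl, ?_⟩))
    all_goals
      simp only [List.flatMap_cons, List.flatMap_append, List.flatMap_nil, List.length_append,
        List.concat_eq_append, List.cons_append, List.length_nil] at hlen ⊢
      omega
  · obtain ⟨l₁, b, l₂, hl, h₁, h₂⟩ := exists_block_at image _ w.length
      (hlen ▸ Nat.lt_add_of_pos_right hw')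
    rcases List.eq_nil_or_concat l₁ with rfl | ⟨l, a, rfl⟩
    · obtain ⟨a, ls, rfl⟩ := List.exists_cons_of_ne_nil hne
      simp only [List.nil_append, List.cons_append, List.cons.injEq] at hl
      obtain ⟨rfl, rfl⟩ := hl
      refine key [] _ _ _ rfl h₁ ?_ (.inr (.inr ⟨rfl, h₂⟩))
      rw [List.length_append]
      omega
    · simp only [List.concat_eq_append, List.flatMap_append, List.flatMap_cons, List.flatMap_nil,
        List.append_nil, List.length_append] at h₁ h₂
      refine key l a b l₂ (by simpa using hl) ?_ ?_ (.inl ⟨?_, ?_⟩) <;>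
        (try rw [List.length_append]) <;> omega

/-- The length of the image of a block. -/
def Block.length : Block → ℕ
  | .short => 41
  | .long => 52
  | .pre => 49
  | .suf => 49

theorem length_image (a : V × Block) : (image a).length = a.2.length := by
  obtain ⟨⟨σ, m⟩, k⟩ := a
  cases k <;> cases m <;> simp [image, applyV, blockBase, Block.length, Qw, Rw, Pw, Sw]

theorem length_flatMap_image (ls : List (V × Block)) :
    (ls.flatMap image).length = ((ls.map Prod.snd).map Block.length).sum := by
  simp [List.length_flatMap, length_image, Function.comp_def]

theorem flatMap_image_mem_substSet {ls : List (V × Block)} (h : ∀ a ∈ ls, label a = Sum.inl a.1) :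
    ls.flatMap image ∈ SubstSet delta ((ls.map Prod.fst).map Sum.inl) := by
  induction ls with
  | nil => rfl
  | cons a ls ih =>
    refine ⟨image a, ?_, _, ih fun b hb => h b (List.mem_cons_of_mem _ hb), rfl⟩
    have ha := h a List.mem_cons_self
    obtain ⟨v, k⟩ := a
    cases k
    · exact Or.inl rfl
    · exact Or.inr rfl
    · cases ha
    · cases ha

theorem SquareFree.cons {α : Type*} {w : List α} {p : α} (hw : SquareFree w) (hp : p ∉ w) :
    SquareFree (p :: w) := by
  intro z hz hs
  rcases List.infix_cons_iff.1 hs with h | h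
  · cases z with
    | nil => exact hz rfl
    | cons q z =>
      obtain ⟨rfl, h'⟩ := List.cons_prefix_cons.1 h
      exact hp (h'.subset (List.mem_append_right z List.mem_cons_self))
  · exact hw z hz h

theorem SquareFree.reverse {α : Type*} {w : List α} (hw : SquareFree w) :
    SquareFree w.reverse := by
  intro z hz hs
  refine hw z.reverse (by simpa using hz) ?_
  simpa using List.reverse_infix.2 hs

theorem SquareFree.concat {α : Type*} {w : List α} {p : α} (hw : SquareFree w) (hp : p ∉ w) :
    SquareFree (w ++ [p]) := by
  have := (hw.reverse.cons (p := p) (by simpa using hp)).reverse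
  simpa using this

theorem extremalSquareFree_of_walk {a b : ℕ} {x y : V} {w' : List V}
    (hl : (x :: w' ++ [y]).length = a + b) (hc : (x :: w' ++ [y]).IsChain Arc)
    (hs : SquareFree (x :: w' ++ [y])) :
    ∃ W ∈ SubstSet delta ((x :: w' ++ [y]).map Sum.inl), W.length = 41 * a + 52 * b ∧
      (pword x ++ W ++ sword y).length = 41 * a + 52 * b + 98 ∧
      ExtremalSquareFree (pword x ++ W ++ sword y) := by
  set ks := List.replicate a Block.short ++ List.replicate b Block.long with hks
  set ls := (x :: w' ++ [y]).zip ks with hls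
  have hkl : ks.length = (x :: w' ++ [y]).length := by
    rw [hl, hks, List.length_append, List.length_replicate, List.length_replicate]
  have hfst : ls.map Prod.fst = x :: w' ++ [y] := List.map_fst_zip hkl.ge
  have hsnd : ls.map Prod.snd = ks := List.map_snd_zip hkl.le
  have hlab : ∀ c ∈ ls, label c = Sum.inl c.1 := by
    rintro ⟨v, k⟩ hk
    have := (List.of_mem_zip hk).2
    rw [hks, List.mem_append, List.mem_replicate, List.mem_replicate] at this
    rcases this with ⟨-, rfl⟩ | ⟨-, rfl⟩ <;> rfl
  have hmap : ls.map label = (x :: w' ++ [y]).map Sum.inl := by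
    rw [← hfst, List.map_map]
    exact List.map_congr_left hlab
  have hW : (ls.flatMap image).length = 41 * a + 52 * b := by
    rw [length_flatMap_image, hsnd]
    simp [hks, Block.length, mul_comm]
  have hT : ((x, Block.pre) :: ls ++ [(y, Block.suf)]).flatMap image
      = pword x ++ ls.flatMap image ++ sword y := by
    simp only [List.cons_append, List.flatMap_cons, List.flatMap_append, List.flatMap_nil,
      List.append_nil, List.append_assoc]
    rfl
  have hTl : ((x, Block.pre) :: ls ++ [(y, Block.suf)]).map label
      = Sum.inr (x, false) :: (x :: w' ++ [y]).map Sum.inl ++ [Sum.inr (y, true)] := by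
    rw [List.map_append, List.map_cons, hmap]
    rfl
  have hchain : ((x, Block.pre) :: ls ++ [(y, Block.suf)]).IsChain BlockArc := by
    refine (List.isChain_map label (R := ArcHat)).1 ?_
    rw [hTl]
    have h₁ : ((x :: w' ++ [y]).map (Sum.inl : V → Vhat)).IsChain ArcHat :=
      (List.isChain_map _).2 hc
    refine List.isChain_append.2 ⟨?_, List.isChain_singleton _, ?_⟩
    · exact List.isChain_cons_cons.2 ⟨rfl, h₁⟩
    · intro u hu v hv
      rw [List.map_append, ← List.cons_append, List.map_singleton, List.getLast?_concat,
        Option.mem_some] at hu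
      rw [List.head?_singleton, Option.mem_some] at hv
      rw [← hu, ← hv]
      rfl
  have hne : ls ≠ [] := by
    rintro h
    rw [h] at hfst
    simp at hfst
  refine ⟨ls.flatMap image, hfst ▸ flatMap_image_mem_substSet hlab, hW, ?_, ?_, ?_⟩
  · have h₁ : (pword x).length = 49 := length_image (x, .pre)
    have h₂ : (sword y).length = 49 := length_image (y, .suf)
    rw [List.length_append, List.length_append, hW, h₁, h₂]
    ring
  · rw [← hT]
    refine isSyncCode_image.squareFree_flatMap hchain ?_
    rw [hTl]
    refine ((hs.map Sum.inl_injective).cons ?_).concat ?_ <;> simp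
  · rintro v ⟨u, u', c, hu, rfl⟩
    exact not_squareFree_insert hne hchain (hT.trans hu) c

end Blocks

section Existence

theorem SquareFree.isChain_ne {α : Type*} {w : List α} (hw : SquareFree w) :
    w.IsChain (· ≠ ·) := by
  induction w with
  | nil => exact List.isChain_nil
  | cons a w ih =>
    cases w with
    | nil => exact List.isChain_singleton a
    | cons b w =>
      refine List.isChain_cons_cons.2 ⟨?_, ih (hw.of_infix (List.suffix_cons a _).isInfix)⟩
      rintro rfl
      exact hw [a] (by simp) ⟨[], w, rfl⟩

theorem squareFree_of_forall_take_ne {α : Type*} {w : List α}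
    (h : ∀ k < w.length / 2, ∀ i < w.length - (2 * k + 1),
      (w.drop i).take (k + 1) ≠ (w.drop (i + (k + 1))).take (k + 1)) : SquareFree w := by
  rintro x hx ⟨s, t, rfl⟩
  have hpos := List.length_pos_iff.2 hx
  simp only [List.length_append] at h
  refine h (x.length - 1) (by omega) s.length (by omega) ?_
  rw [Nat.sub_add_cancel hpos, ← List.drop_drop, List.append_assoc, List.append_assoc,
    List.drop_left, List.drop_left, List.take_left, List.take_left]

/-- A criterion for uniform substitutions on three letters. -/
theorem isSyncCode_of_uniform {α : Type*} {h : Fin 3 → List α} {N p q : ℕ} (hp : 0 < p)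
    (hq : 0 < q) (hpq : p + q ≤ N + 1) (hlen : ∀ a, (h a).length = N)
    (hpre : ∀ a b, (h a).take q = (h b).take q → a = b)
    (hsuf : ∀ a b, (h a).drop (N - p) = (h b).drop (N - p) → a = b)
    (hsync : ∀ a b c, a ≠ b → ∀ o < N, 0 < o → ((h a).drop o ++ h b).take N ≠ h c)
    (hfree : ∀ a b c, a ≠ b → b ≠ c → SquareFree (h a ++ h b ++ h c)) :
    IsSyncCode (· ≠ ·) id h N p q where
  p_pos := hp
  q_pos := hq
  add_le := hpq
  le_length a := (hlen a).ge
  eq_of_prefix a b hab :=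
    hpre a b (by rw [hab.eq_of_length ((hlen a).trans (hlen b).symm)])
  label_eq_of_prefix a b u hu := by
    rintro ⟨s, hs⟩ ⟨t, ht⟩
    refine hpre a b ?_
    rw [← hs, ← ht, List.take_append_of_le_length hu, List.take_append_of_le_length hu]
  label_eq_of_suffix a b u hu := by
    rintro ⟨s, hs⟩ ⟨t, ht⟩
    have ha := hlen a
    have hb := hlen b
    refine hsuf a b ?_
    rw [← hs, List.length_append] at ha
    rw [← ht, List.length_append] at hb
    rw [← hs, ← ht, show N - p = s.length + (u.length - p) by omega, List.drop_length_add_append,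
      show s.length = t.length by omega, List.drop_length_add_append]
  sync_single a c o ho hol := by
    have := hlen a
    omega
  sync_pair a b c o hE ho hoa := by
    have ha := hlen a
    have hb := hlen b
    have hc := hlen c
    refine ⟨fun h₁ => ?_, fun ⟨t, ht⟩ => hsync a b c hE o (by omega) ho ?_⟩
    · have := h₁.length_le
      simp only [List.length_take, List.length_append, List.length_drop] at this
      omega
    · have := congrArg (List.take N) ht
      rw [List.take_take, min_eq_left (Nat.le_succ N), ← hc, List.take_left] at this
      rw [← hc]
      exact this.symm
  squareFree_short u hu hc := by
    have hne : ∀ a : Fin 3, a ≠ a + 1 := by decide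
    match u, hc with
    | [], _ => intro x hx hs; simp_all
    | [a], _ =>
      refine (hfree a (a + 1) (a + 1 + 1) (hne a) (hne _)).of_infix ?_
      exact ⟨[], h (a + 1) ++ h (a + 1 + 1), by simp⟩
    | [a, b], hc =>
      refine (hfree a b (b + 1) (List.isChain_cons_cons.1 hc).1 (hne b)).of_infix ?_
      exact ⟨[], h (b + 1), by simp⟩
    | [a, b, c], hc =>
      simp only [List.isChain_cons_cons] at hc
      simpa using hfree a b c hc.1 hc.2.1
    | _ :: _ :: _ :: _ :: _, _ => simp only [List.length_cons] at hu; omega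

/-- Leech's square-free substitution. -/
def leech : Fin 3 → List (Fin 3)
  | 0 => [0, 1, 2, 1, 0, 2, 1, 2, 0, 1, 2, 1, 0]
  | 1 => [1, 2, 0, 2, 1, 0, 2, 0, 1, 2, 0, 2, 1]
  | 2 => [2, 0, 1, 0, 2, 1, 0, 1, 2, 0, 1, 0, 2]

theorem isSyncCode_leech : IsSyncCode (· ≠ ·) id leech 13 1 1 :=
  isSyncCode_of_uniform (by decide) (by decide) (by decide) (by decide) (by decide) (by decide)
    (by decide +kernel) fun a b c hab hbc => squareFree_of_freeCheck (by
      revert a b c; decide +kernel)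

theorem exists_squareFree_length_gt (n : ℕ) :
    ∃ w : List (Fin 3), SquareFree w ∧ n < w.length := by
  induction n with
  | zero => exact ⟨[0], squareFree_of_freeCheck (by decide), by simp⟩
  | succ n ih =>
    obtain ⟨w, hw, hn⟩ := ih
    refine ⟨w.flatMap leech,
      isSyncCode_leech.squareFree_flatMap hw.isChain_ne (by simpa using hw), ?_⟩
    have : (w.flatMap leech).length = w.length * 13 := by
      rw [List.length_flatMap, List.map_congr_left (g := fun _ => 13) fun a _ => by
        fin_cases a <;> rfl]
      simp
    omega

/-- Three closed walks of length six in `D`. -/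
def closedWalk : Fin 3 → List V
  | 0 => [(pid, false), (pab, true), (pacb, false), (pbc, true), (pabc, false), (pac, true)]
  | 1 => [(pid, false), (pab, true), (pacb, false), (pac, false), (pabc, true), (pbc, false)]
  | 2 => [(pid, false), (pab, true), (pabc, true), (pbc, false), (pacb, true), (pac, true)]

theorem isSyncCode_closedWalk : IsSyncCode (· ≠ ·) id closedWalk 6 2 4 :=
  isSyncCode_of_uniform (by decide) (by decide) (by decide) (by decide) (by decide +kernel)
    (by decide +kernel) (by decide +kernel) fun a b c hab hbc => squareFree_of_forall_take_ne (by
      revert a b c; decide +kernel)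

theorem isChain_flatMap_closedWalk (w : List (Fin 3)) :
    (w.flatMap closedWalk).IsChain Arc := by
  induction w with
  | nil => exact List.isChain_nil
  | cons a w ih =>
    rw [List.flatMap_cons]
    refine List.isChain_append.2 ⟨?_, ih, ?_⟩
    · have : ∀ a, (closedWalk a).IsChain fun x y => (x, y) ∈ arcs := by decide +kernel
      exact this a
    · intro x hx y hy
      have hy' : y = (pid, false) := by
        cases w with
        | nil => simp at hy
        | cons b w => fin_cases b <;> simpa [closedWalk, eq_comm] using hy
      rw [hy', Arc]
      revert x a
      decide +kernel

theorem exists_squareFree_walk {m : ℕ} (hm : 2 ≤ m) :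
    ∃ (x y : V) (w : List V), (x :: w ++ [y]).length = m ∧ (x :: w ++ [y]).IsChain Arc ∧
      SquareFree (x :: w ++ [y]) := by
  obtain ⟨w, hw, hwm⟩ := exists_squareFree_length_gt m
  have hs := isSyncCode_closedWalk.squareFree_flatMap hw.isChain_ne (by simpa using hw)
  have hc := isChain_flatMap_closedWalk w
  have hl : (w.flatMap closedWalk).length = w.length * 6 := by
    rw [List.length_flatMap, List.map_congr_left (g := fun _ => 6) fun a _ => by
      fin_cases a <;> rfl]
    simp
  obtain ⟨x, l, hx⟩ : ∃ x l, (w.flatMap closedWalk).take m = x :: l :=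
    List.exists_cons_of_length_pos (by rw [List.length_take]; omega)
  have hlen := congrArg List.length hx
  rw [List.length_take, List.length_cons] at hlen
  obtain ⟨l', y, rfl⟩ := (List.eq_nil_or_concat l).resolve_left (by
    rintro rfl
    rw [List.length_nil] at hlen
    omega)
  rw [List.concat_eq_append, ← List.cons_append] at hx
  refine ⟨x, y, l', ?_, ?_, ?_⟩
  · rw [← hx, List.length_take]; omega
  · rw [← hx]; exact hc.prefix (List.take_prefix _ _)
  · rw [← hx]; exact hs.of_infix (List.take_prefix _ _).isInfix

theorem exists_eq_add_mul {n : ℕ} (hn : 2040 ≤ n) : ∃ a b, n = 41 * a + 52 * b :=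
  ⟨52 * (15 * n / 41) - 19 * n, 15 * n % 41, by omega⟩

end Existence

/-- For every `n ≥ 2138`: if `n - 98 = 41a + 52b` and `w = x w' y` is any square-free walk
in `D` of length `a + b`, then `δ(w)` contains a word `W` of length `n - 98`, and the
unique word in `δ(p_x) W δ(s_y)` is an extremal square-free word of length `n`.
In particular, there is an extremal square-free ternary word of length `n`. -/
theorem extremal_all_large_lengths (n : ℕ) (hn : 2138 ≤ n) :
    (∀ a b : ℕ, n - 98 = 41 * a + 52 * b →
      ∀ (x y : V) (w' : List V),
        (x :: w' ++ [y]).length = a + b →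
        List.Chain' Arc (x :: w' ++ [y]) →
        SquareFree (x :: w' ++ [y]) →
        ∃ W ∈ SubstSet delta ((x :: w' ++ [y]).map Sum.inl),
          W.length = n - 98 ∧
          (pword x ++ W ++ sword y).length = n ∧
          ExtremalSquareFree (pword x ++ W ++ sword y)) ∧
    ∃ W : List (Fin 3), W.length = n ∧ ExtremalSquareFree W := by
  have key : ∀ a b : ℕ, n - 98 = 41 * a + 52 * b → ∀ (x y : V) (w' : List V),
      (x :: w' ++ [y]).length = a + b → (x :: w' ++ [y]).IsChain Arc →
      SquareFree (x :: w' ++ [y]) → ∃ W ∈ SubstSet delta ((x :: w' ++ [y]).map Sum.inl),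
        W.length = n - 98 ∧ (pword x ++ W ++ sword y).length = n ∧
        ExtremalSquareFree (pword x ++ W ++ sword y) := by
    intro a b hab x y w' hl hc hs
    obtain ⟨W, hW, h₁, h₂, h₃⟩ := extremalSquareFree_of_walk hl hc hs
    exact ⟨W, hW, by omega, by omega, h₃⟩
  refine ⟨key, ?_⟩
  obtain ⟨a, b, hab⟩ := exists_eq_add_mul (n := n - 98) (by omega)
  obtain ⟨x, y, w', hl, hc, hs⟩ := exists_squareFree_walk (m := a + b) (by omega)
  obtain ⟨W, -, -, hW, hext⟩ := key a b hab x y w' hl hc hs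
  exact ⟨_, hW, hext⟩
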